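/- arXiv:1305.5663 — 2 statements merged into one kernel-verified Lean document; each statement's English description precedes it below -/
import Mathlib

section
/- The even subalgebra Cl⁺(3,0,1) (the motor algebra) is isomorphic as an ℝ-algebra to the dual quaternions, i.e. to the algebra of dual numbers over ℍ (the algebra ℍ[ε] with ε² = 0). -/
open CliffordAlgebra TrivSqZeroExt

namespace MotorAlgebra

/-- The quadratic form of signature `(3,0,1)`. -/
noncomputable abbrev form : QuadraticForm ℝ (Fin 4 → ℝ) :=
  QuadraticMap.weightedSumSquares ℝ (![1, 1, 1, 0] : Fin 4 → ℝ)

theorem form_apply (x : Fin 4 → ℝ) : form x = x 0 * x 0 + x 1 * x 1 + x 2 * x 2 := by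
  simp [QuadraticMap.weightedSumSquares_apply, Fin.sum_univ_four]

/-- The pure quaternion `x₀ i + x₁ j + x₂ k`. -/
noncomputable def pureQuaternion : (Fin 4 → ℝ) →ₗ[ℝ] Quaternion ℝ where
  toFun x := ⟨0, x 0, x 1, x 2⟩
  map_add' _ _ := QuaternionAlgebra.ext (add_zero 0).symm rfl rfl rfl
  map_smul' r _ := QuaternionAlgebra.ext (mul_zero r).symm rfl rfl rfl

@[simp] theorem re_pureQuaternion (x : Fin 4 → ℝ) : (pureQuaternion x).re = 0 := rfl

@[simp] theorem imI_pureQuaternion (x : Fin 4 → ℝ) : (pureQuaternion x).imI = x 0 := rfl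

@[simp] theorem imJ_pureQuaternion (x : Fin 4 → ℝ) : (pureQuaternion x).imJ = x 1 := rfl

@[simp] theorem imK_pureQuaternion (x : Fin 4 → ℝ) : (pureQuaternion x).imK = x 2 := rfl

/-- The vector `x` as the dual quaternion `x₀ i + x₁ j + x₂ k + x₃ ε`. -/
noncomputable def toDual : (Fin 4 → ℝ) →ₗ[ℝ] DualNumber (Quaternion ℝ) where
  toFun x := inl (pureQuaternion x) + inr (x 3 : Quaternion ℝ)
  map_add' x y := by ext <;> simp
  map_smul' r x := by ext <;> simp

/-- The vector `x` as the dual quaternion `-x₀ i - x₁ j - x₂ k + x₃ ε`. -/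
noncomputable def toDualConj : (Fin 4 → ℝ) →ₗ[ℝ] DualNumber (Quaternion ℝ) where
  toFun x := inl (-pureQuaternion x) + inr (x 3 : Quaternion ℝ)
  map_add' x y := by ext <;> simp <;> ring
  map_smul' r x := by ext <;> simp

theorem toDual_apply (x : Fin 4 → ℝ) :
    toDual x = inl (pureQuaternion x) + inr (x 3 : Quaternion ℝ) := rfl

theorem toDualConj_apply (x : Fin 4 → ℝ) :
    toDualConj x = inl (-pureQuaternion x) + inr (x 3 : Quaternion ℝ) := rfl

theorem algebraMap_eq_inl_coe (r : ℝ) :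
    algebraMap ℝ (DualNumber (Quaternion ℝ)) r = inl (r : Quaternion ℝ) := rfl

theorem toDual_mul_toDualConj (x : Fin 4 → ℝ) :
    toDual x * toDualConj x = algebraMap ℝ _ (form x) := by
  rw [form_apply, algebraMap_eq_inl_coe, toDual_apply, toDualConj_apply]
  refine TrivSqZeroExt.ext ?_ ?_
  · ext <;> simp <;> ring
  · ext <;> refine Eq.trans (b := (0 : ℝ)) ?_ rfl <;> simp <;> ring

theorem toDualConj_mul_toDual (x : Fin 4 → ℝ) :
    toDualConj x * toDual x = algebraMap ℝ _ (form x) := by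
  rw [form_apply, algebraMap_eq_inl_coe, toDual_apply, toDualConj_apply]
  refine TrivSqZeroExt.ext ?_ ?_
  · ext <;> simp <;> ring
  · ext <;> refine Eq.trans (b := (0 : ℝ)) ?_ rfl <;> simp <;> ring

/-- The algebra morphism sending a product `x y` of vectors to `toDual x * toDualConj y`. -/
noncomputable def evenToDual : even form →ₐ[ℝ] DualNumber (Quaternion ℝ) :=
  even.lift form
    { bilin := (LinearMap.mul ℝ _).compl₁₂ toDual toDualConj
      contract := toDual_mul_toDualConj
      contract_mid := fun x y z => by
        simp only [LinearMap.compl₁₂_apply, LinearMap.mul_apply']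
        rw [mul_assoc, ← mul_assoc (toDualConj y), toDualConj_mul_toDual, Algebra.left_comm,
          Algebra.smul_def] }

theorem evenToDual_bilin (x y : Fin 4 → ℝ) :
    evenToDual ((even.ι form).bilin x y) = toDual x * toDualConj y :=
  even.lift_ι ..

/-- The standard generators of the Clifford algebra. -/
noncomputable def gen (a : Fin 4) : CliffordAlgebra form := ι form (Pi.single a 1)

theorem gen_mul_gen_swap {a b : Fin 4} (h : a ≠ b) : gen a * gen b = -(gen b * gen a) := by
  refine ι_mul_ι_comm_of_isOrtho ?_
  rw [QuadraticMap.isOrtho_def]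
  revert h
  fin_cases a <;> fin_cases b <;> simp only [form_apply] <;> simp

theorem gen_mul_gen_mul_swap {a b : Fin 4} (h : a ≠ b) (x : CliffordAlgebra form) :
    gen a * (gen b * x) = -(gen b * (gen a * x)) := by
  rw [← mul_assoc, gen_mul_gen_swap h, neg_mul, mul_assoc]

theorem gen_mul_self {a : Fin 4} (h : a ≠ 3) : gen a * gen a = 1 := by
  rw [gen, ι_sq_scalar, form_apply]
  revert h
  fin_cases a <;> simp

theorem gen_mul_self_mul {a : Fin 4} (h : a ≠ 3) (x : CliffordAlgebra form) :
    gen a * (gen a * x) = x := by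
  rw [← mul_assoc, gen_mul_self h, one_mul]

theorem gen_three_mul_self : gen 3 * gen 3 = 0 := by
  rw [gen, ι_sq_scalar, form_apply]
  simp

theorem gen_three_mul_self_mul (x : CliffordAlgebra form) : gen 3 * (gen 3 * x) = 0 := by
  rw [← mul_assoc, gen_three_mul_self, zero_mul]

theorem ι_eq_gen (x : Fin 4 → ℝ) :
    ι form x = x 0 • gen 0 + x 1 • gen 1 + x 2 • gen 2 + x 3 • gen 3 := by
  simp only [gen, ← map_smul, ← map_add]
  congr 1
  ext a
  fin_cases a <;> simp

/-- The product of two standard generators, as an element of the even subalgebra. -/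
noncomputable def bivector (a b : Fin 4) : even form :=
  (even.ι form).bilin (Pi.single a 1) (Pi.single b 1)

@[simp]
theorem coe_bivector (a b : Fin 4) : (bivector a b : CliffordAlgebra form) = gen a * gen b := rfl

/-- Sorts products of two generators by increasing index. -/
theorem sort_gen_mul :
    gen 1 * gen 0 = -(gen 0 * gen 1) ∧ gen 2 * gen 0 = -(gen 0 * gen 2) ∧
    gen 3 * gen 0 = -(gen 0 * gen 3) ∧ gen 2 * gen 1 = -(gen 1 * gen 2) ∧
    gen 3 * gen 1 = -(gen 1 * gen 3) ∧ gen 3 * gen 2 = -(gen 2 * gen 3) := by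
  refine ⟨?_, ?_, ?_, ?_, ?_, ?_⟩ <;> exact gen_mul_gen_swap (by decide)

theorem sort_gen_mul_mul (x : CliffordAlgebra form) :
    gen 1 * (gen 0 * x) = -(gen 0 * (gen 1 * x)) ∧
    gen 2 * (gen 0 * x) = -(gen 0 * (gen 2 * x)) ∧
    gen 3 * (gen 0 * x) = -(gen 0 * (gen 3 * x)) ∧
    gen 2 * (gen 1 * x) = -(gen 1 * (gen 2 * x)) ∧
    gen 3 * (gen 1 * x) = -(gen 1 * (gen 3 * x)) ∧
    gen 3 * (gen 2 * x) = -(gen 2 * (gen 3 * x)) := by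
  refine ⟨?_, ?_, ?_, ?_, ?_, ?_⟩ <;> exact gen_mul_gen_mul_swap (by decide) x

theorem contract_gen :
    (gen 0 * gen 0 = 1 ∧ gen 1 * gen 1 = 1 ∧ gen 2 * gen 2 = 1 ∧ gen 3 * gen 3 = 0) ∧
    ∀ x, gen 0 * (gen 0 * x) = x ∧ gen 1 * (gen 1 * x) = x ∧ gen 2 * (gen 2 * x) = x ∧
      gen 3 * (gen 3 * x) = 0 :=
  ⟨⟨gen_mul_self (by decide), gen_mul_self (by decide), gen_mul_self (by decide),
    gen_three_mul_self⟩, fun x => ⟨gen_mul_self_mul (by decide) x,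
    gen_mul_self_mul (by decide) x, gen_mul_self_mul (by decide) x, gen_three_mul_self_mul x⟩⟩

/-- The quaternion units as bivectors `i = e₂e₁`, `j = e₀e₂`, `k = e₁e₀`. -/
noncomputable def quaternionBasis :
    QuaternionAlgebra.Basis (even form) (-1 : ℝ) 0 (-1) where
  i := bivector 2 1
  j := bivector 0 2
  k := bivector 1 0
  i_mul_i := Subtype.ext <| by simp [mul_assoc, sort_gen_mul, sort_gen_mul_mul, contract_gen]
  j_mul_j := Subtype.ext <| by simp [mul_assoc, sort_gen_mul_mul, contract_gen]
  i_mul_j := Subtype.ext <| by simp [mul_assoc, sort_gen_mul, sort_gen_mul_mul, contract_gen]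
  j_mul_i := Subtype.ext <| by simp [mul_assoc, sort_gen_mul, sort_gen_mul_mul, contract_gen]

/-- The embedding of the quaternions in the even subalgebra. -/
noncomputable def quaternionToEven : Quaternion ℝ →ₐ[ℝ] even form :=
  QuaternionAlgebra.Basis.liftHom quaternionBasis

theorem quaternionToEven_apply (q : Quaternion ℝ) :
    quaternionToEven q = algebraMap ℝ _ q.re + q.imI • bivector 2 1 + q.imJ • bivector 0 2 +
      q.imK • bivector 1 0 := rfl

theorem coe_quaternionToEven (q : Quaternion ℝ) :
    (quaternionToEven q : CliffordAlgebra form) =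
      algebraMap ℝ _ q.re + q.imI • (gen 2 * gen 1) + q.imJ • (gen 0 * gen 2) +
        q.imK • (gen 1 * gen 0) := rfl

/-- The pseudoscalar `e₀e₁e₂e₃`. -/
noncomputable def pseudoscalar : even form := bivector 0 1 * bivector 2 3

theorem pseudoscalar_mul_self : pseudoscalar * pseudoscalar = 0 :=
  Subtype.ext <| by simp [pseudoscalar, mul_assoc, sort_gen_mul_mul, contract_gen]

theorem commute_pseudoscalar (q : Quaternion ℝ) :
    Commute pseudoscalar (quaternionToEven q) :=
  Subtype.ext <| by
    simp [pseudoscalar, coe_quaternionToEven, mul_add, add_mul, mul_assoc, sort_gen_mul,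
      sort_gen_mul_mul, contract_gen, Algebra.algebraMap_eq_smul_one]

/-- The algebra morphism extending `quaternionToEven` that sends `ε` to the pseudoscalar. -/
noncomputable def dualToEven : DualNumber (Quaternion ℝ) →ₐ[ℝ] even form :=
  DualNumber.lift
    ⟨(quaternionToEven, pseudoscalar), pseudoscalar_mul_self, commute_pseudoscalar⟩

theorem dualToEven_apply (x : DualNumber (Quaternion ℝ)) :
    dualToEven x = quaternionToEven x.fst + quaternionToEven x.snd * pseudoscalar := rfl

theorem coe_dualToEven_toDual (x : Fin 4 → ℝ) :
    (dualToEven (toDual x) : CliffordAlgebra form) = -(ι form x * (gen 0 * gen 1 * gen 2)) := by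
  rw [dualToEven_apply, Subalgebra.coe_add, Subalgebra.coe_mul, coe_quaternionToEven,
    coe_quaternionToEven, ι_eq_gen]
  simp [toDual_apply, pseudoscalar, add_mul, mul_assoc, sort_gen_mul, sort_gen_mul_mul,
    contract_gen, Algebra.algebraMap_eq_smul_one]
  module

theorem coe_dualToEven_toDualConj (x : Fin 4 → ℝ) :
    (dualToEven (toDualConj x) : CliffordAlgebra form) = gen 0 * gen 1 * gen 2 * ι form x := by
  rw [dualToEven_apply, Subalgebra.coe_add, Subalgebra.coe_mul, coe_quaternionToEven,
    coe_quaternionToEven, ι_eq_gen]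
  simp [toDualConj_apply, pseudoscalar, mul_add, mul_assoc, sort_gen_mul, sort_gen_mul_mul,
    contract_gen, Algebra.algebraMap_eq_smul_one]

theorem dualToEven_comp_evenToDual : dualToEven.comp evenToDual = AlgHom.id ℝ _ := by
  refine even.algHom_ext form (EvenHom.ext (LinearMap.ext₂ fun x y => Subtype.ext ?_))
  change ((dualToEven (evenToDual ((even.ι form).bilin x y)) : even form) :
    CliffordAlgebra form) = ι form x * ι form y
  rw [evenToDual_bilin, map_mul, Subalgebra.coe_mul, coe_dualToEven_toDual,
    coe_dualToEven_toDualConj]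
  simp [mul_assoc, sort_gen_mul_mul, contract_gen]

theorem evenToDual_bivector (a b : Fin 4) :
    evenToDual (bivector a b) = toDual (Pi.single a 1) * toDualConj (Pi.single b 1) :=
  evenToDual_bilin ..

theorem evenToDual_quaternionToEven (q : Quaternion ℝ) :
    evenToDual (quaternionToEven q) = inl q := by
  simp only [quaternionToEven_apply, map_add, map_smul, AlgHom.commutes, evenToDual_bivector,
    toDual_apply, toDualConj_apply, algebraMap_eq_inl_coe]
  ext <;> simp

theorem evenToDual_pseudoscalar : evenToDual pseudoscalar = DualNumber.eps := by
  simp only [pseudoscalar, map_mul, evenToDual_bivector, toDual_apply, toDualConj_apply]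
  ext <;> simp <;> rfl

theorem evenToDual_comp_dualToEven : evenToDual.comp dualToEven = AlgHom.id ℝ _ := by
  refine AlgHom.ext fun x => ?_
  rw [AlgHom.comp_apply, dualToEven_apply, map_add, map_mul, evenToDual_quaternionToEven,
    evenToDual_quaternionToEven, evenToDual_pseudoscalar]
  ext <;> simp

end MotorAlgebra

/-- The even subalgebra `Cl⁺(3,0,1)` (the motor algebra), i.e. the even subalgebra of the
Clifford algebra over ℝ of the diagonal quadratic form on `ℝ⁴` with coefficients
`(+1,+1,+1,0)`, is isomorphic as an ℝ-algebra to the dual quaternions, i.e. to the algebra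
`ℍ[ε]` of dual numbers over the quaternions (with `ε² = 0`). -/
theorem even_subalgebra_Cl_3_0_1_iso_dual_quaternions :
    Nonempty
      ((CliffordAlgebra.even
          (QuadraticMap.weightedSumSquares ℝ (![1, 1, 1, 0] : Fin 4 → ℝ))) ≃ₐ[ℝ]
        DualNumber (Quaternion ℝ)) := by
  exact ⟨AlgEquiv.ofAlgHom MotorAlgebra.evenToDual MotorAlgebra.dualToEven
    MotorAlgebra.evenToDual_comp_dualToEven MotorAlgebra.dualToEven_comp_evenToDual⟩
end

section
/- Let n be a positive integer, equip V = ℝⁿ × ℝ × ℝ with the quadratic form Q(x, α, β) = |x|² − 2αβ, let P(x) = (x, 1, |x|²/2) be the conformal point embedding, and let ι : V → CliffordAlgebra Q be the canonical embedding. For any x, y ∈ ℝⁿ, the bisector vector σ = ι(P(x)) − ι(P(y)) reflects one conformal point to the other: σ · ι(P(x)) · σ = −|x − y|² • ι(P(y)). -/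
open scoped BigOperators

/-- In a Clifford algebra, the difference of two vectors of equal quadratic value reflects one
to the other. -/
theorem CliffordAlgebra.ι_sub_ι_mul_ι_mul_ι_sub_ι {R M : Type*} [CommRing R] [AddCommGroup M]
    [Module R M] {Q : QuadraticForm R M} {a b : M} (h : Q a = Q b) :
    (ι Q a - ι Q b) * ι Q a * (ι Q a - ι Q b) = (-Q (a - b)) • ι Q b := by
  have hsq : ι Q a * ι Q a = ι Q b * ι Q b := by
    rw [ι_sq_scalar, ι_sq_scalar, h]
  have hcomm : ι Q a * (ι Q b * ι Q b) = ι Q b * (ι Q b * ι Q a) := by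
    rw [ι_sq_scalar, ← Algebra.commutes, ← ι_sq_scalar, mul_assoc]
  rw [neg_smul, Algebra.smul_def, ← ι_sq_scalar, map_sub]
  simp only [sub_mul, mul_sub, hsq, hcomm, mul_assoc]
  abel

/-- Equip `V = ℝⁿ × ℝ × ℝ` (`n > 0`) with the conformal quadratic form
`Q (x, α, β) = |x|² - 2αβ`, let `P x = (x, 1, |x|²/2)` be the conformal point embedding and
`ι : V → CliffordAlgebra Q` the canonical embedding.  For any `x, y : ℝⁿ`, the bisector
vector `σ = ι (P x) - ι (P y)` reflects one conformal point to the other: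
`σ * ι (P x) * σ = (-|x - y|²) • ι (P y)`. -/
theorem conformal_bisector_reflects_points (n : ℕ) (hn : 0 < n)
    (Q : QuadraticForm ℝ ((Fin n → ℝ) × ℝ × ℝ))
    (hQ : ∀ (x : Fin n → ℝ) (α β : ℝ), Q (x, α, β) = (∑ i, x i ^ 2) - 2 * α * β) :
    ∀ x y : Fin n → ℝ,
      (CliffordAlgebra.ι Q (x, 1, (∑ i, x i ^ 2) / 2) -
          CliffordAlgebra.ι Q (y, 1, (∑ i, y i ^ 2) / 2)) *
        CliffordAlgebra.ι Q (x, 1, (∑ i, x i ^ 2) / 2) *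
        (CliffordAlgebra.ι Q (x, 1, (∑ i, x i ^ 2) / 2) -
          CliffordAlgebra.ι Q (y, 1, (∑ i, y i ^ 2) / 2)) =
      (-∑ i, (x i - y i) ^ 2) • CliffordAlgebra.ι Q (y, 1, (∑ i, y i ^ 2) / 2) := by
  intro x y
  have hnull (z : Fin n → ℝ) : Q (z, 1, (∑ i, z i ^ 2) / 2) = 0 := by
    rw [hQ]
    ring
  rw [CliffordAlgebra.ι_sub_ι_mul_ι_mul_ι_sub_ι ((hnull x).trans (hnull y).symm)]
  simp [hQ]
end
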